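/- Let f : ℂ → ℂ be an entire function satisfying the quasi-periodicity equation f(z+m) = e^{2πiαm} e^{ν(z+m/2)m} f(z) for all z ∈ ℂ, m ∈ ℤ, with ∫_S |f(z)|² e^{−ν|z|²} dm(z) < ∞. If ∫_S f(z) conj(ψₙ(z)) e^{−ν|z|²} dm(z) = 0 for every n ∈ ℤ, then f is identically zero; in other words, the orthonormal system (ψₙ)_{n∈ℤ} is complete in this space. -/

import Mathlib

open Complex MeasureTheory ENNReal

/-- The orthonormal basis functions
`ψₙ(z) = (2ν/π)^{1/4} e^{−(π²/ν)(n+α)²} e^{(ν/2)z² + 2πi(α+n)z}`. -/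
noncomputable def psiN (α ν : ℝ) (n : ℤ) (z : ℂ) : ℂ :=
  (((2 * ν / Real.pi) ^ ((1 : ℝ) / 4) *
      Real.exp (-(Real.pi ^ 2 / ν) * (n + α) ^ 2) : ℝ) : ℂ) *
    Complex.exp (ν / 2 * z ^ 2 + 2 * Real.pi * Complex.I * (α + n) * z)

/-- The identification `ℂ ≃ ℝ × ℝ` carries Lebesgue measure on the strip `0 ≤ Re z ≤ 1` to the
product of Lebesgue measure on `[0, 1]` and on `ℝ`. -/
theorem measurePreserving_strip :
    MeasurePreserving Complex.measurableEquivRealProd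
      (volume.restrict {z : ℂ | z.re ∈ Set.Icc (0 : ℝ) 1})
      ((volume.restrict (Set.Icc (0 : ℝ) 1)).prod (volume : Measure ℝ)) := by
  have h := Complex.volume_preserving_equiv_real_prod.restrict_preimage
    ((measurableSet_Icc (a := (0 : ℝ)) (b := 1)).prod (MeasurableSet.univ (α := ℝ)))
  have hpre : Complex.measurableEquivRealProd ⁻¹' (Set.Icc (0 : ℝ) 1 ×ˢ Set.univ) =
      {z : ℂ | z.re ∈ Set.Icc (0 : ℝ) 1} := by
    ext z; simp
  rwa [hpre, Measure.volume_eq_prod, ← Measure.prod_restrict, Measure.restrict_univ] at h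

theorem setIntegral_strip_eq {F : ℂ → ℂ}
    (hF : IntegrableOn F {z : ℂ | z.re ∈ Set.Icc (0 : ℝ) 1}) :
    ∫ z in {z : ℂ | z.re ∈ Set.Icc (0 : ℝ) 1}, F z =
      ∫ y : ℝ, ∫ x in (0 : ℝ)..1, F (x + y * I) := by
  have hmp := measurePreserving_strip.symm
  rw [← hmp.integral_comp', integral_prod_symm]
  · refine integral_congr_ae (Filter.Eventually.of_forall fun y => ?_)
    simp only
    rw [intervalIntegral.integral_of_le zero_le_one, ← integral_Icc_eq_integral_Ioc]
    simp [Complex.measurableEquivRealProd_symm_apply, Complex.mk_eq_add_mul_I]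
  · exact (hmp.integrable_comp_emb (MeasurableEquiv.measurableEmbedding _)).2 hF

theorem integrable_exp_neg_mul_sq_sub_mul {a : ℝ} (ha : 0 < a) (b : ℝ) :
    Integrable fun y : ℝ => Real.exp (-a * y ^ 2 - b * y) := by
  have h := (integrable_cexp_quadratic (b := (a : ℂ)) (by simpa using ha) (-(b : ℂ)) 0).norm
  refine h.congr (Filter.Eventually.of_forall fun y => ?_)
  have : (-(a : ℂ) * (y : ℂ) ^ 2 + -(b : ℂ) * y + 0) = ((-a * y ^ 2 - b * y : ℝ) : ℂ) := by
    push_cast; ring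
  simp only [this, Complex.norm_exp, Complex.ofReal_re]

/-- The integral of a `1`-periodic entire function over a horizontal period does not depend on
the height. -/
theorem intervalIntegral_horizontal_eq {h : ℂ → ℂ} (hh : Differentiable ℂ h)
    (hper : Function.Periodic h 1) (y : ℝ) :
    ∫ x in (0 : ℝ)..1, h (x + y * I) = ∫ x in (0 : ℝ)..1, h x := by
  have H := Complex.integral_boundary_rect_eq_zero_of_differentiableOn h 0 (1 + y * I)
    hh.differentiableOn
  have hside : ∀ t : ℝ, h (1 + t * I) = h (t * I) := fun t => by
    rw [add_comm]; exact hper _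
  simp [hside] at H
  exact (sub_eq_zero.1 H).symm

/-- A continuous `1`-periodic function all of whose Fourier coefficients vanish is zero. -/
theorem eq_zero_of_fourier_integrals_eq_zero {g : ℝ → ℂ} (hg : Continuous g)
    (hper : Function.Periodic g 1)
    (hcoeff : ∀ n : ℤ, ∫ x in (0 : ℝ)..1, Complex.exp (-(2 * Real.pi * I * n * x)) * g x = 0)
    (x : ℝ) : g x = 0 := by
  have : Fact ((0 : ℝ) < 1) := ⟨zero_lt_one⟩
  let G : C(AddCircle (1 : ℝ), ℂ) := ⟨hper.lift, continuous_coinduced_dom.2 hg⟩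
  have hG : ∀ x : ℝ, G x = g x := fun x => rfl
  have hc : ∀ n, fourierCoeff G n = 0 := fun n => by
    rw [fourierCoeff_eq_intervalIntegral G n 0]
    simp only [hG, fourier_coe_apply, smul_eq_mul, zero_add]
    refine smul_eq_zero_of_right _ ((intervalIntegral.integral_congr fun x _ => ?_).trans
      (hcoeff n))
    congr 2
    push_cast; ring
  have hs : Summable (fourierCoeff G) := by
    rw [show fourierCoeff G = fun _ => 0 from funext hc]; exact summable_zero
  have h0 := hasSum_fourier_series_of_summable hs
  simp only [hc, zero_smul] at h0
  rw [← hG, h0.unique hasSum_zero]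
  rfl

theorem conj_psiN_mul_weight (α ν : ℝ) (n : ℤ) (z : ℂ) :
    (starRingEnd ℂ) (psiN α ν n z) * Real.exp (-ν * Complex.normSq z) =
      (((2 * ν / Real.pi) ^ ((1 : ℝ) / 4) *
        Real.exp (-(Real.pi ^ 2 / ν) * (n + α) ^ 2) : ℝ) : ℂ) *
      Complex.exp (-(ν / 2 * z ^ 2 + 2 * Real.pi * I * (α + n) * z)) *
      Real.exp (-(2 * ν) * z.im ^ 2 - 4 * Real.pi * (α + n) * z.im) := by
  rw [psiN, map_mul, Complex.conj_ofReal, ← Complex.exp_conj, mul_assoc,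
    mul_assoc (Complex.ofReal _) (Complex.exp (-_)), Complex.ofReal_exp (-ν * _),
    Complex.ofReal_exp (_ - _), ← Complex.exp_add, ← Complex.exp_add]
  congr 2
  obtain ⟨x, y⟩ := z
  apply Complex.ext
  · rw [Complex.add_re, Complex.conj_re]
    simp [Complex.normSq_apply, pow_two]; ring
  · rw [Complex.add_im, Complex.conj_im]
    simp [Complex.normSq_apply, pow_two]

theorem norm_sq_psiN_mul_weight (α ν : ℝ) (n : ℤ) (z : ℂ) :
    ‖psiN α ν n z‖ ^ 2 * Real.exp (-ν * Complex.normSq z) =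
      ((2 * ν / Real.pi) ^ ((1 : ℝ) / 4) *
        Real.exp (-(Real.pi ^ 2 / ν) * (n + α) ^ 2)) ^ 2 *
      Real.exp (-(2 * ν) * z.im ^ 2 - 4 * Real.pi * (α + n) * z.im) := by
  rw [psiN, norm_mul, mul_pow, Complex.norm_real, Real.norm_eq_abs, sq_abs, Complex.norm_exp,
    ← Real.exp_nat_mul, mul_assoc, ← Real.exp_add]
  congr 2
  obtain ⟨x, y⟩ := z
  simp [Complex.normSq_apply, pow_two]; ring

theorem continuous_psiN (α ν : ℝ) (n : ℤ) : Continuous (psiN α ν n) := by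
  unfold psiN; fun_prop

theorem integrableOn_norm_sq_psiN {ν : ℝ} (hν : 0 < ν) (α : ℝ) (n : ℤ) :
    IntegrableOn (fun z => ‖psiN α ν n z‖ ^ 2 * Real.exp (-ν * Complex.normSq z))
      {z : ℂ | z.re ∈ Set.Icc (0 : ℝ) 1} := by
  simp only [norm_sq_psiN_mul_weight]
  refine Integrable.const_mul ?_ _
  have h1 : Integrable (fun _ : ℝ => (1 : ℝ)) (volume.restrict (Set.Icc (0 : ℝ) 1)) :=
    integrable_const _
  have h := h1.mul_prod (integrable_exp_neg_mul_sq_sub_mul (a := 2 * ν) (by positivity)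
    (4 * Real.pi * (α + n)))
  have h' := (measurePreserving_strip.integrable_comp_emb
    (MeasurableEquiv.measurableEmbedding _)).2 h
  simpa [Function.comp_def] using h'

theorem integrableOn_mul_conj_psiN {ν : ℝ} (hν : 0 < ν) (α : ℝ) (n : ℤ) {f : ℂ → ℂ}
    (hf : Continuous f)
    (hfin : (∫⁻ z in {z : ℂ | z.re ∈ Set.Icc (0 : ℝ) 1},
        (‖f z‖₊ : ℝ≥0∞) ^ 2 * ENNReal.ofReal (Real.exp (-ν * Complex.normSq z))) ≠ ⊤) :
    IntegrableOn (fun z => f z * (starRingEnd ℂ) (psiN α ν n z) *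
      Real.exp (-ν * Complex.normSq z)) {z : ℂ | z.re ∈ Set.Icc (0 : ℝ) 1} := by
  have hψc := continuous_psiN α ν n
  have hw : Continuous fun z : ℂ => Real.exp (-ν * Complex.normSq z) := by fun_prop
  have hfi : IntegrableOn (fun z => ‖f z‖ ^ 2 * Real.exp (-ν * Complex.normSq z))
      {z : ℂ | z.re ∈ Set.Icc (0 : ℝ) 1} := by
    refine ⟨((hf.norm.pow 2).mul hw).aestronglyMeasurable, ?_⟩
    rw [HasFiniteIntegral]
    refine lt_of_eq_of_lt (lintegral_congr fun z => ?_) hfin.lt_top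
    rw [← ofReal_norm, Real.norm_of_nonneg (by positivity),
      ENNReal.ofReal_mul (by positivity), ENNReal.ofReal_pow (norm_nonneg _), ofReal_norm]
    rfl
  refine Integrable.mono' (hfi.add (integrableOn_norm_sq_psiN hν α n)) ?_ ?_
  · refine Continuous.aestronglyMeasurable ?_
    exact (hf.mul (Complex.continuous_conj.comp hψc)).mul (Complex.continuous_ofReal.comp hw)
  · refine Filter.Eventually.of_forall fun z => ?_
    simp only [norm_mul, RCLike.norm_conj, Complex.norm_real, Pi.add_apply,
      Real.norm_of_nonneg (Real.exp_pos _).le]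
    rw [← add_mul]
    gcongr
    nlinarith [sq_nonneg (‖f z‖ - ‖psiN α ν n z‖), sq_nonneg ‖f z‖, sq_nonneg ‖psiN α ν n z‖]

/-- Completeness of the orthonormal system `(ψₙ)_{n∈ℤ}`: if an entire
quasi-periodic function `f` with finite weighted `L²` norm on the strip `S` is orthogonal
to every `ψₙ`, then `f` is identically zero. -/
theorem stmt_7 (α ν : ℝ) (hν : 0 < ν) (f : ℂ → ℂ) (hf : Differentiable ℂ f)
    (hqp : ∀ (z : ℂ) (m : ℤ), f (z + m) =
        Complex.exp (2 * Real.pi * Complex.I * α * m) *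
          Complex.exp (ν * (z + m / 2) * m) * f z)
    (hfin : (∫⁻ z in {z : ℂ | z.re ∈ Set.Icc (0 : ℝ) 1},
        (‖f z‖₊ : ℝ≥0∞) ^ 2 * ENNReal.ofReal (Real.exp (-ν * Complex.normSq z))) ≠ ⊤)
    (horth : ∀ n : ℤ,
      (∫ z in {z : ℂ | z.re ∈ Set.Icc (0 : ℝ) 1},
        f z * (starRingEnd ℂ) (psiN α ν n z) * Real.exp (-ν * Complex.normSq z)) = 0) :
    ∀ z : ℂ, f z = 0 := by
  let h : ℤ → ℂ → ℂ := fun n z =>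
    f z * Complex.exp (-(ν / 2 * z ^ 2 + 2 * Real.pi * I * (α + n) * z))
  have hdiff : ∀ n, Differentiable ℂ (h n) := fun n => by
    simp only [h]; fun_prop
  have hper : ∀ n, Function.Periodic (h n) 1 := fun n z => by
    have h1 := hqp z 1
    simp only [Int.cast_one, mul_one] at h1
    simp only [h, h1]
    rw [mul_comm _ (f z), mul_assoc, ← Complex.exp_add, ← Complex.exp_add]
    congr 1
    rw [Complex.exp_eq_exp_iff_exists_int]
    refine ⟨-n, ?_⟩
    push_cast; ring
  have hzero : ∀ n, ∫ x in (0 : ℝ)..1, h n x = 0 := fun n => by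
    have key := horth n
    rw [setIntegral_strip_eq (integrableOn_mul_conj_psiN hν α n hf.continuous hfin)] at key
    have hA : 0 < (2 * ν / Real.pi) ^ ((1 : ℝ) / 4) *
        Real.exp (-(Real.pi ^ 2 / ν) * (n + α) ^ 2) := by positivity
    set A := (2 * ν / Real.pi) ^ ((1 : ℝ) / 4) * Real.exp (-(Real.pi ^ 2 / ν) * (n + α) ^ 2)
      with hAdef
    have hinner : ∀ y : ℝ, (∫ x in (0 : ℝ)..1, f (x + y * I) *
        (starRingEnd ℂ) (psiN α ν n (x + y * I)) *
          Real.exp (-ν * Complex.normSq (x + y * I))) =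
        (A * ∫ x in (0 : ℝ)..1, h n x) *
          (Real.exp (-(2 * ν) * y ^ 2 - 4 * Real.pi * (α + n) * y) : ℝ) := fun y => by
      rw [← intervalIntegral_horizontal_eq (hdiff n) (hper n) y,
        ← intervalIntegral.integral_const_mul, ← intervalIntegral.integral_mul_const]
      congr 1
      ext x
      rw [mul_assoc, conj_psiN_mul_weight, ← hAdef]
      have him : ((x : ℂ) + y * I).im = y := by simp
      simp only [him, h]
      ring
    simp only [hinner] at key
    rw [integral_const_mul, integral_complex_ofReal] at key
    have hpos := integral_exp_pos (integrable_exp_neg_mul_sq_sub_mul (a := 2 * ν)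
      (by positivity) (4 * Real.pi * (α + n)))
    have hA0 : (A : ℂ) ≠ 0 := Complex.ofReal_ne_zero.2 hA.ne'
    exact (mul_eq_zero.1 ((mul_eq_zero.1 key).resolve_right
      (Complex.ofReal_ne_zero.2 hpos.ne'))).resolve_left hA0
  intro z
  have hline : h 0 (z.re + z.im * I) = 0 := by
    refine eq_zero_of_fourier_integrals_eq_zero (g := fun x : ℝ => h 0 (x + z.im * I))
      ((hdiff 0).continuous.comp (by fun_prop)) (fun x => ?_) (fun n => ?_) z.re
    · have := hper 0 (x + z.im * I)
      simp only [← this]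
      congr 1
      push_cast; ring
    · have hn := intervalIntegral_horizontal_eq (hdiff n) (hper n) z.im
      rw [hzero n] at hn
      rw [← mul_zero (Complex.exp (2 * Real.pi * I * n * (z.im * I))), ← hn,
        ← intervalIntegral.integral_const_mul]
      congr 1
      ext x
      simp only [h]
      rw [mul_left_comm, mul_left_comm _ (f _), ← Complex.exp_add, ← Complex.exp_add]
      congr 2
      push_cast; ring
  rw [Complex.re_add_im] at hline
  exact (mul_eq_zero.1 hline).resolve_right (Complex.exp_ne_zero _)
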